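/- There exist η ∈ (0,1) and c_* > 0 with the following property: for every R ∈ SO(3), every v ∈ ℝ³ with 1 − η ≤ |v| < 1, and every a ∈ ℝ³, one has ∫_{S²} |R(φ_v(x)) + a − x|² dσ(x) ≥ c_*. -/

import Mathlib

open MeasureTheory RealInnerProductSpace Real

noncomputable section

abbrev E3 := EuclideanSpace ℝ (Fin 3)

/-- The standard surface measure `σ` on `S² ⊂ ℝ³`, with `σ(S²) = 4π`. -/
def sphMeasure : Measure (Metric.sphere (0 : E3) 1) := volume.toSphere

/-- The Möbius transformation `φ_v(x) = ((1 − |v|²)x + 2(1 + v·x)v)/(1 + |v|² + 2 v·x)`. -/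
def mob (v x : E3) : E3 :=
  (1 + ‖v‖ ^ 2 + 2 * ⟪v, x⟫)⁻¹ • ((1 - ‖v‖ ^ 2) • x + (2 * (1 + ⟪v, x⟫)) • v)

/-- The action of a `3 × 3` real matrix on `ℝ³`. -/
def matAct (R : Matrix (Fin 3) (Fin 3) ℝ) (x : E3) : E3 := Matrix.toEuclideanLin R x

open Metric in
lemma measurePreserving_neg_sphMeasure :
    MeasurePreserving (fun x : sphere (0 : E3) 1 ↦ -x) sphMeasure sphMeasure := by
  have hm : Measurable (fun x : sphere (0 : E3) 1 ↦ -x) := continuous_neg.measurable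
  refine ⟨hm, ?_⟩
  ext s hs
  rw [Measure.map_apply hm hs, sphMeasure, Measure.toSphere_apply' _ hs,
    Measure.toSphere_apply' _ (hm hs)]
  congr 1
  rw [← Measure.measure_neg volume]
  congr 1
  ext y
  simp only [Set.mem_neg, Set.mem_smul, Set.mem_image, Set.mem_preimage]
  constructor
  · rintro ⟨r, hr, _, ⟨x, hx, rfl⟩, h⟩
    exact ⟨r, hr, _, ⟨-x, hx, rfl⟩, by rw [coe_neg_sphere, smul_neg, h, neg_neg]⟩
  · rintro ⟨r, hr, _, ⟨x, hx, rfl⟩, h⟩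
    exact ⟨r, hr, _, ⟨-x, by simpa using hx, rfl⟩, by rw [coe_neg_sphere, smul_neg, h]⟩

lemma exists_norm_eq_one_inner_eq_zero (v : E3) : ∃ u : E3, ‖u‖ = 1 ∧ ⟪v, u⟫ = 0 := by
  have h := Submodule.finrank_add_finrank_orthogonal (ℝ ∙ v)
  have h1 := finrank_span_le_card (R := ℝ) ({v} : Set E3)
  simp only [finrank_euclideanSpace, Fintype.card_fin, Set.toFinset_singleton,
    Finset.card_singleton] at h h1
  have : Nontrivial (ℝ ∙ v)ᗮ := Module.nontrivial_of_finrank_pos (R := ℝ) (by omega)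
  obtain ⟨u, hu⟩ := exists_norm_eq (ℝ ∙ v)ᗮ zero_le_one
  exact ⟨u, hu, Submodule.mem_orthogonal_singleton_iff_inner_right.mp u.2⟩

lemma norm_matAct {R : Matrix (Fin 3) (Fin 3) ℝ} (hR : R ∈ Matrix.orthogonalGroup (Fin 3) ℝ)
    (x : E3) : ‖matAct R x‖ = ‖x‖ := by
  have h : Matrix.transpose R * R = 1 := (Matrix.mem_orthogonalGroup_iff' _ _).mp hR
  rw [← sq_eq_sq₀ (norm_nonneg _) (norm_nonneg _), ← real_inner_self_eq_norm_sq,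
    ← real_inner_self_eq_norm_sq, EuclideanSpace.inner_eq_star_dotProduct,
    EuclideanSpace.inner_eq_star_dotProduct]
  simp [matAct, Matrix.dotProduct_mulVec, Matrix.vecMul_mulVec, h]

lemma mob_denom_pos {v x : E3} (hv : ‖v‖ < 1) (hx : ‖x‖ = 1) :
    0 < 1 + ‖v‖ ^ 2 + 2 * ⟪v, x⟫ := by
  have h := abs_le.mp (abs_real_inner_le_norm v x)
  rw [hx, mul_one] at h
  nlinarith [h.1, norm_nonneg v]

lemma mob_sub_eq {v x : E3} (hD : 1 + ‖v‖ ^ 2 + 2 * ⟪v, x⟫ ≠ 0) :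
    mob v x - v = ((1 + ‖v‖ ^ 2 + 2 * ⟪v, x⟫)⁻¹ * (1 - ‖v‖ ^ 2)) • (x + v) := by
  rw [mob]
  match_scalars <;> field_simp
  ring

lemma norm_mob_sub_le {v x : E3} (hv : 1 - 1 / 24 ≤ ‖v‖) (hv' : ‖v‖ < 1) (hx : ‖x‖ = 1)
    (hs : |⟪v, x⟫| ≤ 1 / 3) : ‖mob v x - v‖ ≤ 1 / 2 := by
  have hD := mob_denom_pos hv' hx
  have hs' := abs_le.mp hs
  have h2 : ‖x + v‖ ≤ 2 := (norm_add_le _ _).trans (by linarith)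
  have hv2 : 0 ≤ 1 - ‖v‖ ^ 2 := by nlinarith [norm_nonneg v]
  rw [mob_sub_eq hD.ne', norm_smul, Real.norm_of_nonneg (by positivity), inv_mul_eq_div,
    div_mul_eq_mul_div, div_le_iff₀ hD]
  nlinarith

lemma one_half_le_norm_sq_add_norm_sq {p q x c : E3} (hx : ‖x‖ = 1) (hp : ‖p‖ ≤ 1 / 2)
    (hq : ‖q‖ ≤ 1 / 2) : 1 / 2 ≤ ‖p + c - x‖ ^ 2 + ‖q + c - -x‖ ^ 2 := by
  have h1 : ‖(2 : ℝ) • x‖ = 2 := by rw [norm_smul, hx]; norm_num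
  have h2 : (2 : ℝ) • x = (q + c - -x) - (p + c - x) + (p - q) := by
    rw [two_smul]; abel
  have h3 := norm_add_le ((q + c - -x) - (p + c - x)) (p - q)
  rw [← h2, h1] at h3
  have h4 := norm_sub_le (q + c - -x) (p + c - x)
  have h5 := norm_sub_le p q
  nlinarith [sq_nonneg (‖p + c - x‖ - ‖q + c - -x‖)]

/-- the boundary barrier estimate: there are `η ∈ (0,1)` and `c_* > 0` such
that `∫_{S²} |R(φ_v(x)) + a − x|² dσ ≥ c_*` for every rotation `R ∈ SO(3)`, every `v` with
`1 − η ≤ |v| < 1` and every translation `a ∈ ℝ³`. -/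
theorem stmt14 :
    ∃ η ∈ Set.Ioo (0 : ℝ) 1, ∃ cstar : ℝ, 0 < cstar ∧
      ∀ R : Matrix (Fin 3) (Fin 3) ℝ, R ∈ Matrix.specialOrthogonalGroup (Fin 3) ℝ →
        ∀ v : E3, 1 - η ≤ ‖v‖ → ‖v‖ < 1 → ∀ a : E3,
          cstar ≤ ∫ x : Metric.sphere (0 : E3) 1,
            ‖matAct R (mob v (x : E3)) + a - (x : E3)‖ ^ 2 ∂sphMeasure := by
  refine ⟨1 / 24, by norm_num,
    1 / 4 * (Measure.toSphereBallBound 3 (1 / 3) * volume.real (Metric.ball (0 : E3) 1)),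
    ?_, ?_⟩
  · have h1 := Measure.toSphereBallBound_pos 3 (1 / 3)
    have h2 : 0 < volume.real (Metric.ball (0 : E3) 1) :=
      ENNReal.toReal_pos (Metric.measure_ball_pos volume 0 one_pos).ne' measure_ball_lt_top.ne
    positivity
  intro R hR v hv hv' a
  have : IsFiniteMeasure sphMeasure := by rw [sphMeasure]; infer_instance
  obtain ⟨u, hu, hvu⟩ := exists_norm_eq_one_inner_eq_zero v
  set B := Metric.ball (⟨u, by simpa using hu⟩ : Metric.sphere (0 : E3) 1) (1 / 3) with hB
  have hvol := Measure.toSphereBallBound_mul_measureReal_unitBall_le_toSphere_ball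
    (volume : Measure E3) (by norm_num : (0 : ℝ) < 1 / 3) ⟨u, by simpa using hu⟩
  rw [finrank_euclideanSpace, Fintype.card_fin, ← hB, ← sphMeasure] at hvol
  set F : Metric.sphere (0 : E3) 1 → ℝ := fun x ↦ ‖matAct R (mob v (x : E3)) + a - (x : E3)‖ ^ 2
    with hF
  have hnorm (x : Metric.sphere (0 : E3) 1) : ‖(x : E3)‖ = 1 := norm_eq_of_mem_sphere x
  have hcont : Continuous F := by
    have hmob : Continuous fun x : Metric.sphere (0 : E3) 1 ↦ mob v (x : E3) := by
      unfold mob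
      have hD : Continuous fun x : Metric.sphere (0 : E3) 1 ↦
          (1 + ‖v‖ ^ 2 + 2 * ⟪v, (x : E3)⟫)⁻¹ :=
        Continuous.inv₀ (by fun_prop) fun x ↦ (mob_denom_pos hv' (hnorm x)).ne'
      fun_prop
    have hR' : Continuous (matAct R) := LinearMap.continuous_of_finiteDimensional _
    have := hR'.comp hmob
    simp only [Function.comp_def] at this
    fun_prop
  have hint : Integrable F sphMeasure := by
    simpa using hcont.continuousOn.integrableOn_compact (μ := sphMeasure) isCompact_univ
  have hintneg : Integrable (fun x ↦ F (-x)) sphMeasure :=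
    measurePreserving_neg_sphMeasure.integrable_comp_of_integrable hint
  have hneg : ∫ x, F (-x) ∂sphMeasure = ∫ x, F x ∂sphMeasure :=
    measurePreserving_neg_sphMeasure.integral_comp
      (Homeomorph.neg (Metric.sphere (0 : E3) 1)).measurableEmbedding F
  have hsplit (x : E3) : matAct R (mob v x) = matAct R (mob v x - v) + matAct R v := by
    simp [matAct]
  have hpt : ∀ x ∈ B, 1 / 2 ≤ F x + F (-x) := by
    intro x hx
    have hs : |⟪v, (x : E3)⟫| ≤ 1 / 3 := by
      have h1 : ⟪v, (x : E3)⟫ = ⟪v, (x : E3) - u⟫ := by rw [inner_sub_right, hvu, sub_zero]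
      have h2 : ‖(x : E3) - u‖ < 1 / 3 := by simpa [hB, Subtype.dist_eq, dist_eq_norm] using hx
      rw [h1]
      refine (abs_real_inner_le_norm _ _).trans ?_
      nlinarith [norm_nonneg ((x : E3) - u)]
    have hO := (Matrix.mem_specialOrthogonalGroup_iff.mp hR).1
    have hp := norm_mob_sub_le hv hv' (hnorm x) hs
    have hq := norm_mob_sub_le (x := -(x : E3)) hv hv' (by rw [norm_neg, hnorm])
      (by rwa [inner_neg_right, abs_neg])
    rw [← norm_matAct hO] at hp hq
    have := one_half_le_norm_sq_add_norm_sq (c := matAct R v + a) (hnorm x) hp hq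
    rwa [← add_assoc, ← add_assoc, ← hsplit, ← hsplit] at this
  have hle : 1 / 2 * sphMeasure.real B ≤ ∫ x, (F x + F (-x)) ∂sphMeasure :=
    calc 1 / 2 * sphMeasure.real B = ∫ _ in B, (1 / 2 : ℝ) ∂sphMeasure := by
          rw [setIntegral_const, smul_eq_mul, mul_comm]
      _ ≤ ∫ x in B, (F x + F (-x)) ∂sphMeasure :=
          setIntegral_mono_on integrableOn_const
            (hint.add hintneg).integrableOn Metric.isOpen_ball.measurableSet hpt
      _ ≤ ∫ x, (F x + F (-x)) ∂sphMeasure :=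
          setIntegral_le_integral (hint.add hintneg)
            (.of_forall fun x ↦ add_nonneg (sq_nonneg _) (sq_nonneg _))
  rw [integral_add hint hintneg, hneg] at hle
  linarith
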